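/- arXiv:1609.07532 — 6 statements merged into one kernel-verified Lean document; each statement's English description precedes it below -/
import Mathlib

section
/- Let X and Y be Banach spaces and μ0 a Borel probability measure on X. Let Φ : X × Y → ℝ satisfy: (i) there is a nondecreasing function f1 : [0,∞) → [1,∞) such that for every r > 0 there is M(r) ∈ ℝ with Φ(u;y) ≥ M(r) − log f1(‖u‖_X) for all u ∈ X and all y ∈ B_Y(r); (ii) for every r > 0 there is K(r) > 0 with Φ(u;y) ≤ K(r) for all u ∈ B_X(r) and y ∈ B_Y(r); (iii) for every r > 0 there is L(r) > 0 with |Φ(u1;y) − Φ(u2;y)| ≤ L(r)‖u1 − u2‖_X for all u1, u2 ∈ B_X(r) and y ∈ B_Y(r). If u ↦ f1(‖u‖_X) is integrable with respect to μ0, then for every y ∈ Y the normalizing constant Z(y) = ∫_X exp(−Φ(u;y)) dμ0(u) satisfies 0 < Z(y) < ∞, and consequently the posterior measure μ^y defined by dμ^y/dμ0(u) = exp(−Φ(u;y))/Z(y) is a well-defined Borel probability measure on X. -/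
open MeasureTheory Real

/-- A real function that is Lipschitz on every open ball around the origin is continuous. -/
theorem continuous_of_lipschitz_on_balls {E : Type*} [SeminormedAddCommGroup E] {g : E → ℝ}
    (hg : ∀ r > 0, ∃ L : ℝ, ∀ u v : E, ‖u‖ < r → ‖v‖ < r → |g u - g v| ≤ L * ‖u - v‖) :
    Continuous g := by
  refine continuous_iff_continuousAt.2 fun u => ?_
  obtain ⟨L, hL⟩ := hg (‖u‖ + 1) (by positivity)
  refine continuousAt_of_locally_lipschitz zero_lt_one L fun v hv => ?_
  rw [dist_eq_norm] at hv ⊢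
  rw [dist_eq_norm]
  exact hL v u (by linarith [norm_le_norm_add_norm_sub' v u]) (lt_add_one _)

/-- Existence and uniqueness of the posterior measure:
under Assumptions (i)-(iii) on the likelihood potential and integrability of
`f1(‖u‖)` w.r.t. the prior, the normalizing constant `Z(y)` is finite and positive,
and the posterior is a well-defined probability measure. -/
theorem posterior_well_defined
    {X Y : Type*} [NormedAddCommGroup X] [NormedSpace ℝ X] [CompleteSpace X]
    [MeasurableSpace X] [BorelSpace X]
    [NormedAddCommGroup Y] [NormedSpace ℝ Y] [CompleteSpace Y]
    (μ0 : Measure X) [IsProbabilityMeasure μ0]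
    (Φ : X → Y → ℝ) (f1 : ℝ → ℝ)
    (hf1_mono : MonotoneOn f1 (Set.Ici 0))
    (hf1_ge : ∀ t : ℝ, 0 ≤ t → 1 ≤ f1 t)
    (hi : ∀ r > 0, ∃ M : ℝ, ∀ u : X, ∀ y : Y, ‖y‖ < r →
      M - Real.log (f1 ‖u‖) ≤ Φ u y)
    (hii : ∀ r > 0, ∃ K > 0, ∀ u : X, ∀ y : Y, ‖u‖ < r → ‖y‖ < r → Φ u y ≤ K)
    (hiii : ∀ r > 0, ∃ L > 0, ∀ u1 u2 : X, ∀ y : Y,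
      ‖u1‖ < r → ‖u2‖ < r → ‖y‖ < r → |Φ u1 y - Φ u2 y| ≤ L * ‖u1 - u2‖)
    (hint : Integrable (fun u => f1 ‖u‖) μ0) :
    ∀ y : Y,
      Integrable (fun u => Real.exp (-(Φ u y))) μ0 ∧
      0 < ∫ u, Real.exp (-(Φ u y)) ∂μ0 ∧
      IsProbabilityMeasure
        (μ0.withDensity (fun u =>
          ENNReal.ofReal (Real.exp (-(Φ u y)) / ∫ v, Real.exp (-(Φ v y)) ∂μ0))) := by
  intro y
  have hcont : Continuous fun u => Φ u y :=
    continuous_of_lipschitz_on_balls fun r hr => by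
      obtain ⟨L, -, hL⟩ := hiii (max r (‖y‖ + 1)) (lt_max_of_lt_left hr)
      exact ⟨L, fun u v hu hv => hL u v y (lt_max_of_lt_left hu) (lt_max_of_lt_left hv)
        (lt_max_of_lt_right (lt_add_one _))⟩
  obtain ⟨M, hM⟩ := hi (‖y‖ + 1) (by positivity)
  have hbound (u : X) : exp (-(Φ u y)) ≤ exp (-M) * f1 ‖u‖ := by
    have hpos : 0 < f1 ‖u‖ := zero_lt_one.trans_le (hf1_ge _ (norm_nonneg u))
    calc exp (-(Φ u y)) ≤ exp (-M + log (f1 ‖u‖)) :=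
          exp_le_exp.2 (by linarith [hM u y (lt_add_one _)])
      _ = exp (-M) * f1 ‖u‖ := by rw [exp_add, exp_log hpos]
  have hexp : Integrable (fun u => exp (-(Φ u y))) μ0 :=
    (hint.const_mul (exp (-M))).mono' (by fun_prop)
      (.of_forall fun u => by simpa only [norm_eq_abs, abs_exp] using hbound u)
  have hZ : 0 < ∫ u, exp (-(Φ u y)) ∂μ0 := integral_exp_pos hexp
  refine ⟨hexp, hZ, ⟨?_⟩⟩
  rw [withDensity_apply _ .univ, Measure.restrict_univ,
    ← ofReal_integral_eq_lintegral_ofReal (hexp.div_const _)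
    (.of_forall fun u => by positivity), integral_div, div_self hZ.ne', ENNReal.ofReal_one]
end

section
/- Let X and Y be Banach spaces and μ0 a Borel probability measure on X. Let Φ : X × Y → ℝ be such that Φ(·;y) is Borel measurable for each y and: (i) there is a nondecreasing function f1 : [0,∞) → [1,∞) such that for every r > 0 there is M(r) ∈ ℝ with Φ(u;y) ≥ M(r) − log f1(‖u‖_X) for all u ∈ X and all y ∈ B_Y(r); (ii) for every r > 0 there is K(r) > 0 with Φ(u;y) ≤ K(r) for all u ∈ B_X(r) and y ∈ B_Y(r); (iv) there is a nondecreasing function f2 : [0,∞) → [0,∞) such that for every r > 0 there is C(r) > 0 with |Φ(u;y1) − Φ(u;y2)| ≤ C(r) f2(‖u‖_X) ‖y1 − y2‖_Y for all y1, y2 ∈ B_Y(r) and all u ∈ X. If u ↦ f1(‖u‖_X) f2(‖u‖_X) is integrable with respect to μ0, then for every r > 0 there exists a constant C'(r) > 0 such that d_TV(μ^y, μ^{y'}) ≤ C'(r) ‖y − y'‖_Y for all y, y' ∈ B_Y(r), where μ^y and μ^{y'} are the posterior measures with potentials Φ(·;y) and Φ(·;y'). -/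
open MeasureTheory Real

/-- Normalizing two nonnegative integrable densities at most doubles the `L¹` distance between
them, relative to the mass of the first one. -/
lemma half_integral_abs_normalized_sub_le {α : Type*} [MeasurableSpace α] {μ : Measure α}
    {g h : α → ℝ} (hg : Integrable g μ) (hh : Integrable h μ) (hh0 : ∀ u, 0 ≤ h u)
    (hgpos : 0 < ∫ v, g v ∂μ) (hhpos : 0 < ∫ v, h v ∂μ) :
    (1 / 2) * ∫ u, |g u / (∫ v, g v ∂μ) - h u / (∫ v, h v ∂μ)| ∂μ
      ≤ (∫ u, |g u - h u| ∂μ) / ∫ v, g v ∂μ := by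
  set Z := ∫ v, g v ∂μ with hZ
  set W := ∫ v, h v ∂μ with hW
  have hZW : |W - Z| ≤ ∫ u, |g u - h u| ∂μ := by
    rw [abs_sub_comm, hZ, hW, ← integral_sub hg hh]
    exact abs_integral_le_integral_abs
  have hdiff : Integrable (fun u => |g u - h u| / Z) μ := (hg.sub hh).abs.div_const Z
  have hscaled : Integrable (fun u => h u * (|W - Z| / (Z * W))) μ := hh.mul_const _
  have hpt : ∀ u, |g u / Z - h u / W| ≤ |g u - h u| / Z + h u * (|W - Z| / (Z * W)) := by
    intro u
    have heq : g u / Z - h u / W = (g u - h u) / Z + h u * ((W - Z) / (Z * W)) := by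
      field_simp
      ring
    rw [heq]
    refine (abs_add_le _ _).trans_eq ?_
    rw [abs_div, abs_mul, abs_div, abs_of_pos hgpos, abs_of_nonneg (hh0 u),
      abs_of_pos (mul_pos hgpos hhpos)]
  have hle : ∫ u, |g u / Z - h u / W| ∂μ
      ≤ (∫ u, |g u - h u| ∂μ) / Z + |W - Z| / Z := by
    calc ∫ u, |g u / Z - h u / W| ∂μ
        ≤ ∫ u, (|g u - h u| / Z + h u * (|W - Z| / (Z * W))) ∂μ :=
          integral_mono ((hg.div_const Z).sub (hh.div_const W)).abs (hdiff.add hscaled) hpt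
      _ = (∫ u, |g u - h u| ∂μ) / Z + |W - Z| / Z := by
          rw [integral_add hdiff hscaled, integral_div, integral_mul_const, ← hW]
          field_simp
  have hdiv : |W - Z| / Z ≤ (∫ u, |g u - h u| ∂μ) / Z :=
    div_le_div_of_nonneg_right hZW hgpos.le
  linarith

/-- If both exponentials are bounded by `B`, then `x ↦ exp (-x)` is `B`-Lipschitz between them. -/
lemma abs_exp_neg_sub_exp_neg_le {a b B : ℝ} (ha : exp (-a) ≤ B) (hb : exp (-b) ≤ B) :
    |exp (-a) - exp (-b)| ≤ B * |a - b| := by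
  wlog hab : a ≤ b generalizing a b
  · rw [abs_sub_comm, abs_sub_comm a]
    exact this hb ha (le_of_not_ge hab)
  have hexp : exp (-b) ≤ exp (-a) := exp_le_exp.2 (by linarith)
  rw [abs_of_nonneg (by linarith), abs_sub_comm, abs_of_nonneg (by linarith)]
  have heq : exp (-b) = exp (-a) * exp (a - b) := by rw [← exp_add]; ring_nf
  calc exp (-a) - exp (-b) ≤ exp (-a) * (b - a) := by
        rw [heq]
        nlinarith [add_one_le_exp (a - b), exp_pos (-a)]
    _ ≤ B * (b - a) := mul_le_mul_of_nonneg_right ha (by linarith)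

/-- A probability measure on a normed space charges some ball of radius at least `r`. -/
lemma exists_le_radius_measureReal_ball_pos {X : Type*} [NormedAddCommGroup X]
    [MeasurableSpace X] (μ : Measure X) [IsProbabilityMeasure μ] (r : ℝ) :
    ∃ R, r ≤ R ∧ 0 < μ.real (Metric.ball 0 R) := by
  obtain ⟨n, hn⟩ : ∃ n : ℕ, 0 < μ (Metric.ball (0 : X) n) := by
    by_contra! hzero
    have hunion : μ (⋃ n : ℕ, Metric.ball (0 : X) n) = 0 :=
      measure_iUnion_null fun n => nonpos_iff_eq_zero.1 (hzero n)
    rw [Metric.iUnion_ball_nat, measure_univ] at hunion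
    exact one_ne_zero hunion
  refine ⟨max r n, le_max_left _ _, ENNReal.toReal_pos ?_ (measure_ne_top _ _)⟩
  exact (hn.trans_le (measure_mono (Metric.ball_subset_ball (le_max_right _ _)))).ne'

/-- A monotone weight `f` is dominated by a constant plus a multiple of `f * g` as soon as the
monotone function `g` is positive somewhere. -/
lemma le_add_mul_div_of_monotoneOn {f g : ℝ → ℝ} (hf : MonotoneOn f (Set.Ici 0))
    (hf0 : ∀ t, 0 ≤ t → 0 ≤ f t) (hg : MonotoneOn g (Set.Ici 0)) (hg0 : ∀ t, 0 ≤ t → 0 ≤ g t)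
    {s t : ℝ} (hs : 0 ≤ s) (ht : 0 ≤ t) (hgs : 0 < g s) :
    f t ≤ f s + f t * g t / g s := by
  rcases le_total t s with hts | hst
  · have hquot : 0 ≤ f t * g t / g s := div_nonneg (mul_nonneg (hf0 t ht) (hg0 t ht)) hgs.le
    linarith [hf ht hs hts]
  · have hquot : f t ≤ f t * g t / g s := by
      rw [le_div_iff₀ hgs]
      exact mul_le_mul_of_nonneg_left (hg hs ht hst) (hf0 t ht)
    linarith [hf0 s hs]

/-- Local Lipschitz stability of the posterior in the total variation
distance (computed with `ν = μ0`): under Assumptions (i), (ii), (iv) and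
integrability of `f1(‖u‖) f2(‖u‖)` w.r.t. the prior, for every `r > 0` there is
`C'(r) > 0` with `d_TV(μ^y, μ^{y'}) ≤ C'(r) ‖y - y'‖` for all `y, y' ∈ B_Y(r)`. -/
theorem posterior_stability_TV
    {X Y : Type*} [NormedAddCommGroup X] [NormedSpace ℝ X] [CompleteSpace X]
    [MeasurableSpace X] [BorelSpace X]
    [NormedAddCommGroup Y] [NormedSpace ℝ Y] [CompleteSpace Y]
    (μ0 : Measure X) [IsProbabilityMeasure μ0]
    (Φ : X → Y → ℝ)
    (hmeas : ∀ y : Y, Measurable (fun u => Φ u y))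
    (f1 f2 : ℝ → ℝ)
    (hf1_mono : MonotoneOn f1 (Set.Ici 0))
    (hf1_ge : ∀ t : ℝ, 0 ≤ t → 1 ≤ f1 t)
    (hf2_mono : MonotoneOn f2 (Set.Ici 0))
    (hf2_nonneg : ∀ t : ℝ, 0 ≤ t → 0 ≤ f2 t)
    (hi : ∀ r > 0, ∃ M : ℝ, ∀ u : X, ∀ y : Y, ‖y‖ < r →
      M - Real.log (f1 ‖u‖) ≤ Φ u y)
    (hii : ∀ r > 0, ∃ K > 0, ∀ u : X, ∀ y : Y, ‖u‖ < r → ‖y‖ < r → Φ u y ≤ K)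
    (hiv : ∀ r > 0, ∃ C > 0, ∀ u : X, ∀ y1 y2 : Y, ‖y1‖ < r → ‖y2‖ < r →
      |Φ u y1 - Φ u y2| ≤ C * f2 ‖u‖ * ‖y1 - y2‖)
    (hint : Integrable (fun u => f1 ‖u‖ * f2 ‖u‖) μ0) :
    ∀ r > 0, ∃ C' > 0, ∀ y y' : Y, ‖y‖ < r → ‖y'‖ < r →
      (1 / 2) * ∫ u,
          |Real.exp (-(Φ u y)) / (∫ v, Real.exp (-(Φ v y)) ∂μ0) -
            Real.exp (-(Φ u y')) / (∫ v, Real.exp (-(Φ v y')) ∂μ0)| ∂μ0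
        ≤ C' * ‖y - y'‖ := by
  intro r hr
  by_cases hpos : ∃ s, 0 ≤ s ∧ 0 < f2 s
  swap
  · -- `f2` vanishes, so the potential does not depend on the data
    push Not at hpos
    obtain ⟨C, -, hLip⟩ := hiv r hr
    refine ⟨1, one_pos, fun y y' hy hy' => ?_⟩
    have hΦ : ∀ u, Φ u y = Φ u y' := fun u => by
      have hf2 : f2 ‖u‖ = 0 :=
        le_antisymm (hpos _ (norm_nonneg u)) (hf2_nonneg _ (norm_nonneg u))
      have hle := hLip u y y' hy hy'
      rw [hf2, mul_zero, zero_mul] at hle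
      exact sub_eq_zero.1 (abs_nonpos_iff.1 hle)
    simp [hΦ]
  obtain ⟨s, hs, hf2s⟩ := hpos
  obtain ⟨M, hM⟩ := hi r hr
  obtain ⟨C, hC, hLip⟩ := hiv r hr
  obtain ⟨R, hrR, hR⟩ := exists_le_radius_measureReal_ball_pos μ0 r
  obtain ⟨K, -, hK⟩ := hii R (hr.trans_le hrR)
  have hf1_nonneg : ∀ t, 0 ≤ t → 0 ≤ f1 t := fun t ht => zero_le_one.trans (hf1_ge t ht)
  have hbound : ∀ u y, ‖y‖ < r → exp (-(Φ u y)) ≤ exp (-M) * f1 ‖u‖ := fun u y hy => by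
    have hf1_pos : 0 < f1 ‖u‖ := one_pos.trans_le (hf1_ge _ (norm_nonneg u))
    calc exp (-(Φ u y)) ≤ exp (-M + log (f1 ‖u‖)) := exp_le_exp.2 (by linarith [hM u y hy])
      _ = exp (-M) * f1 ‖u‖ := by rw [exp_add, exp_log hf1_pos]
  have hexp_int : ∀ y, ‖y‖ < r → Integrable (fun u => exp (-(Φ u y))) μ0 := fun y hy => by
    have hdom : Integrable (fun u => exp (-M) * (f1 s + f1 ‖u‖ * f2 ‖u‖ / f2 s)) μ0 :=
      ((integrable_const _).add (hint.div_const _)).const_mul _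
    refine hdom.mono' (hmeas y).neg.exp.aestronglyMeasurable (.of_forall fun u => ?_)
    rw [norm_of_nonneg (exp_pos _).le]
    exact (hbound u y hy).trans (mul_le_mul_of_nonneg_left
      (le_add_mul_div_of_monotoneOn hf1_mono hf1_nonneg hf2_mono hf2_nonneg hs (norm_nonneg u)
        hf2s) (exp_pos _).le)
  set c := exp (-K) * μ0.real (Metric.ball 0 R) with hc
  have hc_pos : 0 < c := mul_pos (exp_pos _) hR
  have hZ : ∀ y, ‖y‖ < r → c ≤ ∫ v, exp (-(Φ v y)) ∂μ0 := fun y hy => by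
    refine le_trans ?_ (setIntegral_le_integral (s := Metric.ball 0 R) (hexp_int y hy)
      (.of_forall fun u => (exp_pos _).le))
    refine setIntegral_ge_of_const_le_real measurableSet_ball (measure_ne_top _ _) (fun u hu => ?_)
      (hexp_int y hy).integrableOn
    exact exp_le_exp.2 (neg_le_neg (hK u y (mem_ball_zero_iff.1 hu) (hy.trans_le hrR)))
  set I := ∫ u, f1 ‖u‖ * f2 ‖u‖ ∂μ0 with hI
  have hI_nonneg : 0 ≤ I := integral_nonneg fun u =>
    mul_nonneg (hf1_nonneg _ (norm_nonneg u)) (hf2_nonneg _ (norm_nonneg u))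
  refine ⟨exp (-M) * C * I / c + 1, by positivity, fun y y' hy hy' => ?_⟩
  have hL1 : ∫ u, |exp (-(Φ u y)) - exp (-(Φ u y'))| ∂μ0 ≤ exp (-M) * C * I * ‖y - y'‖ := by
    have hpt : ∀ u, |exp (-(Φ u y)) - exp (-(Φ u y'))|
        ≤ exp (-M) * C * ‖y - y'‖ * (f1 ‖u‖ * f2 ‖u‖) := fun u => by
      refine (abs_exp_neg_sub_exp_neg_le (hbound u y hy) (hbound u y' hy')).trans ?_
      refine (mul_le_mul_of_nonneg_left (hLip u y y' hy hy')
        (mul_nonneg (exp_pos _).le (hf1_nonneg _ (norm_nonneg u)))).trans_eq ?_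
      ring
    refine (integral_mono ((hexp_int y hy).sub (hexp_int y' hy')).abs (hint.const_mul _)
      hpt).trans_eq ?_
    rw [integral_const_mul, ← hI]
    ring
  calc _ ≤ (∫ u, |exp (-(Φ u y)) - exp (-(Φ u y'))| ∂μ0) / ∫ v, exp (-(Φ v y)) ∂μ0 :=
        half_integral_abs_normalized_sub_le (hexp_int y hy) (hexp_int y' hy')
          (fun u => (exp_pos _).le) (hc_pos.trans_le (hZ y hy)) (hc_pos.trans_le (hZ y' hy'))
    _ ≤ exp (-M) * C * I * ‖y - y'‖ / c :=
        div_le_div₀ (by positivity) hL1 hc_pos (hZ y hy)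
    _ ≤ (exp (-M) * C * I / c + 1) * ‖y - y'‖ := by
        rw [add_mul, div_mul_eq_mul_div, one_mul]
        exact le_add_of_nonneg_right (norm_nonneg _)
end

section
/- Let X and Y be Banach spaces and let Φ : X × Y → ℝ satisfy conditions (i)–(iv) of the likelihood assumptions with f1(t) = f2(t) = max{1, t^p} for some p ≥ 0, namely: (i) for every r > 0 there is M(r) ∈ ℝ with Φ(u;y) ≥ M(r) − log max{1, ‖u‖_X^p} for all u ∈ X, y ∈ B_Y(r); (ii) for every r > 0 there is K(r) > 0 with Φ(u;y) ≤ K(r) on B_X(r) × B_Y(r); (iii) for every r > 0 there is L(r) > 0 with |Φ(u1;y) − Φ(u2;y)| ≤ L(r)‖u1 − u2‖_X for u1,u2 ∈ B_X(r), y ∈ B_Y(r); (iv) for every r > 0 there is C(r) > 0 with |Φ(u;y1) − Φ(u;y2)| ≤ C(r) max{1, ‖u‖_X^p} ‖y1 − y2‖_Y for y1,y2 ∈ B_Y(r), u ∈ X. If μ0 is a Borel probability measure on X with ∫_X ‖u‖_X^{⌈2p⌉} dμ0(u) < ∞, then for every y ∈ Y the normalizing constant Z(y) = ∫_X exp(−Φ(u;y))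 dμ0(u) satisfies 0 < Z(y) < ∞, the posterior μ^y with dμ^y/dμ0 = exp(−Φ(·;y))/Z(y) is a well-defined probability measure, and for every r > 0 there is C'(r) > 0 such that d_TV(μ^y, μ^{y'}) ≤ C'(r)‖y − y'‖_Y for all y, y' ∈ B_Y(r). -/
open MeasureTheory Real

/-- A real function that is Lipschitz on every ball is continuous. -/
lemma continuous_of_forall_lipschitz_ball {X : Type*} [NormedAddCommGroup X] {f : X → ℝ}
    (h : ∀ r > 0, ∃ L : ℝ, ∀ u v : X, ‖u‖ < r → ‖v‖ < r → |f u - f v| ≤ L * ‖u - v‖) :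
    Continuous f := by
  refine continuous_iff_continuousAt.2 fun x => ?_
  obtain ⟨L, hL⟩ := h (‖x‖ + 1) (by positivity)
  rw [ContinuousAt, tendsto_iff_norm_sub_tendsto_zero]
  have hlim : Filter.Tendsto (fun u => L * ‖u - x‖) (nhds x) (nhds 0) := by
    have : Continuous fun u : X => L * ‖u - x‖ := by fun_prop
    simpa using this.tendsto x
  refine squeeze_zero' (.of_forall fun _ => norm_nonneg _) ?_ hlim
  have hnear : ∀ᶠ u in nhds x, ‖u‖ < ‖x‖ + 1 :=
    continuous_norm.continuousAt.eventually_lt_const (by simp)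
  filter_upwards [hnear] with u hu
  exact hL u x hu (by simp)

lemma sq_max_one_rpow_le {t p : ℝ} (ht : 0 ≤ t) (hp : 0 ≤ p) :
    max 1 (t ^ p) ^ 2 ≤ 1 + t ^ ⌈2 * p⌉₊ := by
  have hN : 0 ≤ t ^ ⌈2 * p⌉₊ := by positivity
  rcases le_total t 1 with h | h
  · rw [max_eq_left (rpow_le_one ht h hp)]
    linarith
  · rw [max_eq_right (one_le_rpow h hp), ← rpow_natCast, ← rpow_mul ht, ← rpow_natCast t]
    have := rpow_le_rpow_of_exponent_le h
      (show p * ((2 : ℕ) : ℝ) ≤ (⌈2 * p⌉₊ : ℝ) by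
        have := Nat.le_ceil (2 * p)
        push_cast
        linarith)
    linarith

/-- A probability measure charges arbitrarily large balls around the origin. -/
lemma exists_ball_measureReal_pos {X : Type*} [NormedAddCommGroup X] [MeasurableSpace X]
    (μ : Measure X) [IsProbabilityMeasure μ] (r : ℝ) :
    ∃ R, r ≤ R ∧ 0 < R ∧ 0 < μ.real (Metric.ball 0 R) := by
  by_contra! h
  have hnull : ∀ n : ℕ, μ (Metric.ball (0 : X) (max r 1 + n)) = 0 := fun n =>
    (measureReal_eq_zero_iff).1 <| le_antisymm
      (h _ (by linarith [le_max_left r 1, n.cast_nonneg (α := ℝ)])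
        (by linarith [le_max_right r 1, n.cast_nonneg (α := ℝ)])) measureReal_nonneg
  have hcover : ⋃ n : ℕ, Metric.ball (0 : X) (max r 1 + n) = Set.univ := by
    refine Set.eq_univ_of_forall fun x => Set.mem_iUnion.2 ?_
    obtain ⟨n, hn⟩ := exists_nat_gt ‖x‖
    exact ⟨n, by rw [mem_ball_zero_iff]; linarith [le_max_right r 1]⟩
  have := measure_iUnion_null hnull
  rw [hcover] at this
  simp at this

lemma isProbabilityMeasure_withDensity_div_integral {X : Type*} [MeasurableSpace X]
    {μ : Measure X} {h : X → ℝ} (hh : Integrable h μ) (h_nonneg : 0 ≤ h)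
    (hZ : 0 < ∫ u, h u ∂μ) :
    IsProbabilityMeasure (μ.withDensity fun u => ENNReal.ofReal (h u / ∫ v, h v ∂μ)) := by
  constructor
  rw [withDensity_apply _ MeasurableSet.univ, Measure.restrict_univ,
    ← ofReal_integral_eq_lintegral_ofReal (hh.div_const _)
      (.of_forall fun u => div_nonneg (h_nonneg u) hZ.le),
    integral_div, div_self hZ.ne', ENNReal.ofReal_one]

/-- Normalizing two nonnegative densities costs at most a factor `2 / ∫ h` in `L¹`. -/
lemma integral_abs_div_integral_sub_le {X : Type*} [MeasurableSpace X] {μ : Measure X}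
    {h k : X → ℝ} (hh : Integrable h μ) (hk : Integrable k μ) (k_nonneg : 0 ≤ k)
    (hZh : 0 < ∫ u, h u ∂μ) (hZk : 0 < ∫ u, k u ∂μ) :
    ∫ u, |h u / (∫ v, h v ∂μ) - k u / (∫ v, k v ∂μ)| ∂μ ≤
      2 * (∫ u, |h u - k u| ∂μ) / ∫ v, h v ∂μ := by
  have hZ : |(∫ v, h v ∂μ) - ∫ v, k v ∂μ| ≤ ∫ u, |h u - k u| ∂μ := by
    rw [← integral_sub hh hk]
    exact abs_integral_le_integral_abs
  set Zh := ∫ v, h v ∂μ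
  set Zk := ∫ v, k v ∂μ with hZk_def
  have hint : Integrable (fun u => |h u - k u|) μ := (hh.sub hk).abs
  calc ∫ u, |h u / Zh - k u / Zk| ∂μ
      ≤ ∫ u, (|h u - k u| / Zh + k u * (|Zh - Zk| / (Zh * Zk))) ∂μ := by
        refine integral_mono ((hh.div_const _).sub (hk.div_const _)).abs
          ((hint.div_const _).add (hk.mul_const _)) fun u => ?_
        have hsplit : h u / Zh - k u / Zk =
            (h u - k u) / Zh - k u * ((Zh - Zk) / (Zh * Zk)) := by
          field_simp
          ring
        refine (congrArg abs hsplit).trans_le ((abs_sub _ _).trans_eq ?_)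
        rw [abs_div, abs_mul, abs_div, abs_of_pos hZh, abs_of_nonneg (k_nonneg u),
          abs_of_pos (mul_pos hZh hZk)]
    _ = (∫ u, |h u - k u| ∂μ) / Zh + |Zh - Zk| / Zh := by
        rw [integral_add (hint.div_const _) (hk.mul_const _), integral_div, integral_mul_const,
          ← hZk_def]
        field_simp
    _ ≤ 2 * (∫ u, |h u - k u| ∂μ) / Zh := by
        rw [← add_div]
        gcongr
        linarith

/-- Well-posedness under polynomially growing potentials: if `Φ`
satisfies Assumptions (i)-(iv) with `f1(t) = f2(t) = max{1, t^p}` for some `p ≥ 0`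
and the prior has finite raw moment of order `⌈2p⌉`, then the posterior is
well-defined and locally Lipschitz in the data w.r.t. the total variation
distance (computed with `ν = μ0`). -/
theorem well_posedness_bounded_moments
    {X Y : Type*} [NormedAddCommGroup X] [NormedSpace ℝ X] [CompleteSpace X]
    [MeasurableSpace X] [BorelSpace X]
    [NormedAddCommGroup Y] [NormedSpace ℝ Y] [CompleteSpace Y]
    (μ0 : Measure X) [IsProbabilityMeasure μ0]
    (Φ : X → Y → ℝ) (p : ℝ) (hp : 0 ≤ p)
    (hi : ∀ r > 0, ∃ M : ℝ, ∀ u : X, ∀ y : Y, ‖y‖ < r →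
      M - Real.log (max 1 (‖u‖ ^ p)) ≤ Φ u y)
    (hii : ∀ r > 0, ∃ K > 0, ∀ u : X, ∀ y : Y, ‖u‖ < r → ‖y‖ < r → Φ u y ≤ K)
    (hiii : ∀ r > 0, ∃ L > 0, ∀ u1 u2 : X, ∀ y : Y,
      ‖u1‖ < r → ‖u2‖ < r → ‖y‖ < r → |Φ u1 y - Φ u2 y| ≤ L * ‖u1 - u2‖)
    (hiv : ∀ r > 0, ∃ C > 0, ∀ u : X, ∀ y1 y2 : Y, ‖y1‖ < r → ‖y2‖ < r →
      |Φ u y1 - Φ u y2| ≤ C * max 1 (‖u‖ ^ p) * ‖y1 - y2‖)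
    (hmom : Integrable (fun u => ‖u‖ ^ (⌈2 * p⌉₊ : ℕ)) μ0) :
    (∀ y : Y,
      Integrable (fun u => Real.exp (-(Φ u y))) μ0 ∧
      0 < ∫ u, Real.exp (-(Φ u y)) ∂μ0 ∧
      IsProbabilityMeasure
        (μ0.withDensity (fun u =>
          ENNReal.ofReal (Real.exp (-(Φ u y)) / ∫ v, Real.exp (-(Φ v y)) ∂μ0)))) ∧
    (∀ r > 0, ∃ C' > 0, ∀ y y' : Y, ‖y‖ < r → ‖y'‖ < r →
      (1 / 2) * ∫ u,
          |Real.exp (-(Φ u y)) / (∫ v, Real.exp (-(Φ v y)) ∂μ0) -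
            Real.exp (-(Φ u y')) / (∫ v, Real.exp (-(Φ v y')) ∂μ0)| ∂μ0
        ≤ C' * ‖y - y'‖) := by
  have hcont : ∀ y : Y, Continuous fun u => Φ u y := fun y => by
    refine continuous_of_forall_lipschitz_ball fun r hr => ?_
    obtain ⟨L, -, hL⟩ := hiii (max r (‖y‖ + 1)) (lt_max_of_lt_left hr)
    exact ⟨L, fun u v hu hv => hL u v y (lt_max_of_lt_left hu) (lt_max_of_lt_left hv)
      (lt_max_of_lt_right (by simp))⟩
  have hweight : Integrable (fun u : X => max 1 (‖u‖ ^ p) ^ 2) μ0 := by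
    refine ((integrable_const (1 : ℝ)).add hmom).mono' ?_ (.of_forall fun u => ?_)
    · exact ((continuous_const.max
        (continuous_norm.rpow_const fun _ => .inr hp)).pow 2).measurable.aestronglyMeasurable
    · rw [norm_of_nonneg (by positivity)]
      exact sq_max_one_rpow_le (norm_nonneg u) hp
  have hbound : ∀ r > 0, ∃ M : ℝ, ∀ u : X, ∀ y : Y, ‖y‖ < r →
      exp (-Φ u y) ≤ exp (-M) * max 1 (‖u‖ ^ p) := fun r hr => by
    obtain ⟨M, hM⟩ := hi r hr
    refine ⟨M, fun u y hy => ?_⟩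
    have hpos : 0 < max 1 (‖u‖ ^ p) := lt_max_of_lt_left one_pos
    rw [← exp_log hpos, ← exp_add, exp_le_exp]
    linarith [hM u y hy]
  have hint : ∀ y : Y, Integrable (fun u => exp (-Φ u y)) μ0 := fun y => by
    obtain ⟨M, hM⟩ := hbound (‖y‖ + 1) (by positivity)
    refine (hweight.const_mul (exp (-M))).mono'
      (hcont y).neg.rexp.measurable.aestronglyMeasurable (.of_forall fun u => ?_)
    rw [norm_of_nonneg (exp_pos _).le]
    refine (hM u y (by simp)).trans ?_
    gcongr
    exact le_self_pow₀ (le_max_left _ _) two_ne_zero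
  have hZ : ∀ r > 0, ∃ z > 0, ∀ y : Y, ‖y‖ < r → z ≤ ∫ u, exp (-Φ u y) ∂μ0 := fun r hr => by
    obtain ⟨R, hrR, hR, hball⟩ := exists_ball_measureReal_pos μ0 r
    obtain ⟨K, -, hK⟩ := hii R hR
    refine ⟨μ0.real (Metric.ball 0 R) * exp (-K), by positivity, fun y hy => ?_⟩
    calc μ0.real (Metric.ball 0 R) * exp (-K)
        = ∫ _ in Metric.ball (0 : X) R, exp (-K) ∂μ0 := by simp
      _ ≤ ∫ u in Metric.ball (0 : X) R, exp (-Φ u y) ∂μ0 := by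
          refine setIntegral_mono_on (integrable_const _).integrableOn (hint y).integrableOn
            measurableSet_ball fun u hu => exp_le_exp.2 (neg_le_neg ?_)
          exact hK u y (mem_ball_zero_iff.1 hu) (hy.trans_le hrR)
      _ ≤ ∫ u, exp (-Φ u y) ∂μ0 :=
          setIntegral_le_integral (hint y) (.of_forall fun u => (exp_pos _).le)
  have hZpos : ∀ y : Y, 0 < ∫ u, exp (-Φ u y) ∂μ0 := fun y => by
    obtain ⟨z, hz, hzy⟩ := hZ (‖y‖ + 1) (by positivity)
    exact hz.trans_le (hzy y (by simp))
  refine ⟨fun y => ⟨hint y, hZpos y, isProbabilityMeasure_withDensity_div_integral (hint y)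
    (fun u => (exp_pos _).le) (hZpos y)⟩, fun r hr => ?_⟩
  obtain ⟨M, hM⟩ := hbound r hr
  obtain ⟨C, hC, hΦ⟩ := hiv r hr
  obtain ⟨z, hz, hzZ⟩ := hZ r hr
  set W := ∫ u : X, max 1 (‖u‖ ^ p) ^ 2 ∂μ0 with hW
  have hW_nonneg : 0 ≤ W := integral_nonneg fun u => by positivity
  refine ⟨exp (-M) * C * W / z + 1, by positivity, fun y y' hy hy' => ?_⟩
  have hdiff : ∫ u, |exp (-Φ u y) - exp (-Φ u y')| ∂μ0 ≤ exp (-M) * C * W * ‖y - y'‖ :=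
    calc ∫ u, |exp (-Φ u y) - exp (-Φ u y')| ∂μ0
        ≤ ∫ u : X, exp (-M) * C * ‖y - y'‖ * max 1 (‖u‖ ^ p) ^ 2 ∂μ0 := by
          refine integral_mono ((hint y).sub (hint y')).abs (hweight.const_mul _) fun u => ?_
          calc |exp (-Φ u y) - exp (-Φ u y')|
              ≤ exp (-M) * max 1 (‖u‖ ^ p) * |Φ u y - Φ u y'| :=
                abs_exp_neg_sub_exp_neg_le (hM u y hy) (hM u y' hy')
            _ ≤ exp (-M) * max 1 (‖u‖ ^ p) * (C * max 1 (‖u‖ ^ p) * ‖y - y'‖) := by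
                gcongr
                exact hΦ u y y' hy hy'
            _ = exp (-M) * C * ‖y - y'‖ * max 1 (‖u‖ ^ p) ^ 2 := by ring
      _ = exp (-M) * C * W * ‖y - y'‖ := by
          rw [integral_const_mul, ← hW]
          ring
  calc (1 / 2) * ∫ u, |exp (-Φ u y) / (∫ v, exp (-Φ v y) ∂μ0) -
          exp (-Φ u y') / (∫ v, exp (-Φ v y') ∂μ0)| ∂μ0
      ≤ (1 / 2) * (2 * (∫ u, |exp (-Φ u y) - exp (-Φ u y')| ∂μ0) /
          ∫ v, exp (-Φ v y) ∂μ0) := by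
        gcongr
        exact integral_abs_div_integral_sub_le (hint y) (hint y') (fun u => (exp_pos _).le)
          (hZpos y) (hZpos y')
    _ ≤ (1 / 2) * (2 * (exp (-M) * C * W * ‖y - y'‖) / z) := by
        gcongr
        exact hzZ y hy
    _ = exp (-M) * C * W / z * ‖y - y'‖ := by ring
    _ ≤ (exp (-M) * C * W / z + 1) * ‖y - y'‖ := by
        gcongr
        linarith
end

section
/- Let X be a Banach space, Y = ℝ^m, and μ0 a Borel probability measure on X. Let Φ : X × Y → ℝ satisfy Φ(u;y) ≥ 0 for all u, y, with Φ(·;y) Borel measurable for each y, and suppose: (ii) for every r > 0 there is K(r) > 0 with Φ(u;y) ≤ K(r) for all u ∈ B_X(r) and y ∈ B_Y(r); (iv) there is a nondecreasing function f2 : [0,∞) → [0,∞) such that for every r > 0 there is C(r) > 0 with |Φ(u;y1) − Φ(u;y2)| ≤ C(r) f2(‖u‖_X)‖y1 − y2‖_Y for all y1, y2 ∈ B_Y(r) and u ∈ X. Then for every y ∈ Y the posterior μ^y with dμ^y/dμ0 = exp(−Φ(·;y))/Z(y), Z(y) = ∫_X exp(−Φ(u;y)) dμ0(u), is a well-defined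 probability measure; moreover (a) if ∫_X f2(‖u‖_X) dμ0(u) < ∞, then for every r > 0 there is C'(r) > 0 with d_TV(μ^y, μ^{y'}) ≤ C'(r)‖y − y'‖_Y for all y, y' ∈ B_Y(r); (b) if ∫_X f2(‖u‖_X)² dμ0(u) < ∞, then for every r > 0 there is C''(r) > 0 with d_H(μ^y, μ^{y'}) ≤ C''(r)‖y − y'‖_Y for all y, y' ∈ B_Y(r). -/
open MeasureTheory Real

/-- The map `t ↦ exp (-t)` is `1`-Lipschitz on `[0, ∞)`. -/
lemma abs_exp_neg_sub_exp_neg_le_s5 {x y : ℝ} (hx : 0 ≤ x) (hy : 0 ≤ y) :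
    |exp (-x) - exp (-y)| ≤ |x - y| := by
  wlog h : x ≤ y generalizing x y
  · rw [abs_sub_comm, abs_sub_comm x]
    exact this hy hx (le_of_not_ge h)
  have hexp : exp (-y) = exp (-x) * exp (-(y - x)) := by
    rw [← exp_add]
    ring_nf
  have hle : exp (-x) ≤ 1 := exp_le_one_iff.2 (by linarith)
  have hlin : 1 - exp (-(y - x)) ≤ y - x := by linarith [add_one_le_exp (-(y - x))]
  rw [abs_of_nonneg (sub_nonneg.2 (exp_le_exp.2 (neg_le_neg h))), abs_sub_comm,
    abs_of_nonneg (sub_nonneg.2 h), hexp]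
  nlinarith [exp_pos (-x)]

/-- The `L¹` distance of normalized densities is controlled by that of the unnormalized ones. -/
lemma integral_abs_div_integral_sub_le_s5 {α : Type*} [MeasurableSpace α] {μ : Measure α}
    {a b : α → ℝ} (ha : Integrable a μ) (hb : Integrable b μ) (hb0 : ∀ u, 0 ≤ b u)
    (hZa : 0 < ∫ u, a u ∂μ) (hZb : 0 < ∫ u, b u ∂μ) :
    ∫ u, |a u / (∫ v, a v ∂μ) - b u / (∫ v, b v ∂μ)| ∂μ
      ≤ 2 / (∫ v, a v ∂μ) * ∫ u, |a u - b u| ∂μ := by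
  have hdiff : |(∫ u, b u ∂μ) - ∫ u, a u ∂μ| ≤ ∫ u, |a u - b u| ∂μ := by
    rw [abs_sub_comm, ← integral_sub ha hb]
    exact abs_integral_le_integral_abs
  set A := ∫ u, a u ∂μ
  set B := ∫ u, b u ∂μ with hB
  have hpoint : ∀ u, |a u / A - b u / B| ≤ 1 / A * |a u - b u| + b u * (|B - A| / (A * B)) := by
    intro u
    have hsplit : a u / A - b u / B = 1 / A * (a u - b u) + b u * ((B - A) / (A * B)) := by
      field_simp
      ring
    rw [hsplit]
    refine (abs_add_le _ _).trans_eq ?_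
    rw [abs_mul, abs_mul, abs_div (B - A), abs_of_pos (one_div_pos.2 hZa), abs_of_nonneg (hb0 u),
      abs_of_pos (mul_pos hZa hZb)]
  have hab : Integrable (fun u => |a u - b u|) μ := (ha.sub hb).abs
  calc ∫ u, |a u / A - b u / B| ∂μ
      ≤ ∫ u, (1 / A * |a u - b u| + b u * (|B - A| / (A * B))) ∂μ :=
        integral_mono ((ha.div_const A).sub (hb.div_const B)).abs
          ((hab.const_mul _).add (hb.mul_const _)) hpoint
    _ = 1 / A * (∫ u, |a u - b u| ∂μ) + 1 / A * |B - A| := by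
        rw [integral_add (hab.const_mul _) (hb.mul_const _), integral_const_mul,
          integral_mul_const, ← hB]
        field_simp
    _ ≤ 1 / A * (∫ u, |a u - b u| ∂μ) + 1 / A * ∫ u, |a u - b u| ∂μ := by gcongr
    _ = 2 / A * ∫ u, |a u - b u| ∂μ := by ring

/-- The squared `L²` distance of the square roots of normalized densities is controlled by that of
the unnormalized ones. -/
lemma integral_sq_sqrt_div_integral_sub_le {α : Type*} [MeasurableSpace α] {μ : Measure α}
    {a b : α → ℝ} (ha : Integrable a μ) (hb : Integrable b μ) (ha0 : ∀ u, 0 ≤ a u)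
    (hb0 : ∀ u, 0 ≤ b u) (hZa : 0 < ∫ u, a u ∂μ) (hZb : 0 < ∫ u, b u ∂μ) :
    ∫ u, (√(a u / (∫ v, a v ∂μ)) - √(b u / (∫ v, b v ∂μ))) ^ 2 ∂μ
      ≤ (∫ u, (√(a u) - √(b u)) ^ 2 ∂μ) / (√(∫ v, a v ∂μ) * √(∫ v, b v ∂μ)) := by
  have hinteg : Integrable (fun u => √(a u) * √(b u)) μ := by
    refine (ha.add hb).mono'
      ((continuous_sqrt.comp_aestronglyMeasurable ha.1).mul
        (continuous_sqrt.comp_aestronglyMeasurable hb.1)) (.of_forall fun u => ?_)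
    rw [norm_of_nonneg (by positivity), Pi.add_apply]
    nlinarith [sq_nonneg (√(a u) - √(b u)), sq_sqrt (ha0 u), sq_sqrt (hb0 u), ha0 u, hb0 u]
  have hsum : Integrable (fun u => a u + b u) μ := ha.add hb
  have hnum : ∫ u, (√(a u) - √(b u)) ^ 2 ∂μ
      = (∫ u, a u ∂μ) + (∫ u, b u ∂μ) - 2 * ∫ u, √(a u) * √(b u) ∂μ := by
    rw [← integral_add ha hb, ← integral_const_mul,
      ← integral_sub hsum (hinteg.const_mul 2)]
    refine integral_congr_ae (.of_forall fun u => ?_)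
    simp only [sub_sq, sq_sqrt (ha0 u), sq_sqrt (hb0 u)]
    ring
  set A := ∫ u, a u ∂μ with hA
  set B := ∫ u, b u ∂μ with hB
  have hsA : 0 < √A := sqrt_pos.2 hZa
  have hsB : 0 < √B := sqrt_pos.2 hZb
  have hnormalized : ∫ u, (√(a u / A) - √(b u / B)) ^ 2 ∂μ
      = 2 - 2 / (√A * √B) * ∫ u, √(a u) * √(b u) ∂μ := by
    have htwo : (2 : ℝ) = ∫ u, (a u / A + b u / B) ∂μ := by
      rw [integral_add (ha.div_const A) (hb.div_const B), integral_div, integral_div, ← hA, ← hB,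
        div_self hZa.ne', div_self hZb.ne']
      norm_num
    have hsum' : Integrable (fun u => a u / A + b u / B) μ :=
      (ha.div_const A).add (hb.div_const B)
    conv_rhs => enter [1]; rw [htwo]
    rw [← integral_const_mul, ← integral_sub hsum' (hinteg.const_mul _)]
    refine integral_congr_ae (.of_forall fun u => ?_)
    simp only [sub_sq, sq_sqrt (div_nonneg (ha0 u) hZa.le), sq_sqrt (div_nonneg (hb0 u) hZb.le)]
    rw [sqrt_div (ha0 u), sqrt_div (hb0 u)]
    field_simp
    ring
  rw [hnormalized, hnum, le_div_iff₀ (mul_pos hsA hsB), sub_mul, mul_right_comm,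
    div_mul_cancel₀ _ (mul_pos hsA hsB).ne']
  nlinarith [sq_nonneg (√A - √B), sq_sqrt hZa.le, sq_sqrt hZb.le]

/-- If a family of nonnegative potentials is bounded on balls, uniformly over the parameter, then
the normalizing constants are bounded below by a positive constant. -/
lemma exists_pos_le_integral_exp_neg {X ι : Type*} [NormedAddCommGroup X] [MeasurableSpace X]
    [BorelSpace X] (μ : Measure X) [IsProbabilityMeasure μ] (Φ : X → ι → ℝ) (s : Set ι)
    (hinteg : ∀ y, Integrable (fun u => exp (-(Φ u y))) μ)
    (hbdd : ∀ R : ℝ, ∃ K, ∀ u, ∀ y ∈ s, ‖u‖ < R → Φ u y ≤ K) :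
    ∃ c > 0, ∀ y ∈ s, c ≤ ∫ u, exp (-(Φ u y)) ∂μ := by
  obtain ⟨n, hn⟩ : ∃ n : ℕ, μ (Metric.ball 0 n) ≠ 0 := by
    by_contra! h
    have hunion := measure_iUnion_null h
    rw [Metric.iUnion_ball_nat] at hunion
    exact IsProbabilityMeasure.ne_zero μ (Measure.measure_univ_eq_zero.1 hunion)
  obtain ⟨K, hK⟩ := hbdd n
  have hpos : 0 < μ.real (Metric.ball 0 n) := ENNReal.toReal_pos hn (measure_ne_top _ _)
  refine ⟨μ.real (Metric.ball 0 n) * exp (-K), by positivity, fun y hy => ?_⟩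
  calc μ.real (Metric.ball 0 n) * exp (-K) = ∫ _ in Metric.ball (0 : X) n, exp (-K) ∂μ := by
        rw [setIntegral_const, smul_eq_mul]
    _ ≤ ∫ u in Metric.ball (0 : X) n, exp (-(Φ u y)) ∂μ := by
        refine setIntegral_mono_on (integrable_const _) (hinteg y).integrableOn
          Metric.isOpen_ball.measurableSet fun u hu => ?_
        exact exp_le_exp.2 (neg_le_neg (hK u y hy (mem_ball_zero_iff.1 hu)))
    _ ≤ ∫ u, exp (-(Φ u y)) ∂μ :=
        setIntegral_le_integral (hinteg y) (.of_forall fun u => (exp_pos _).le)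

/-- Well-posedness for additive noise models: with finite-dimensional
data `Y = ℝ^m` and a nonnegative potential `Φ` satisfying Assumptions (ii) and (iv),
the posterior is well-defined; if `f2(‖u‖)` (resp. `f2(‖u‖)²`) is integrable w.r.t.
the prior then the posterior is locally Lipschitz in the data in the total variation
(resp. Hellinger) distance (computed with `ν = μ0`). -/
theorem additive_noise_well_posedness
    {X : Type*} [NormedAddCommGroup X] [NormedSpace ℝ X] [CompleteSpace X]
    [MeasurableSpace X] [BorelSpace X]
    (m : ℕ) (μ0 : Measure X) [IsProbabilityMeasure μ0]
    (Φ : X → EuclideanSpace ℝ (Fin m) → ℝ)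
    (hmeas : ∀ y, Measurable (fun u => Φ u y))
    (hnonneg : ∀ u y, 0 ≤ Φ u y)
    (f2 : ℝ → ℝ)
    (hf2_mono : MonotoneOn f2 (Set.Ici 0))
    (hf2_nonneg : ∀ t : ℝ, 0 ≤ t → 0 ≤ f2 t)
    (hii : ∀ r > 0, ∃ K > 0, ∀ (u : X) (y : EuclideanSpace ℝ (Fin m)),
      ‖u‖ < r → ‖y‖ < r → Φ u y ≤ K)
    (hiv : ∀ r > 0, ∃ C > 0, ∀ (u : X) (y1 y2 : EuclideanSpace ℝ (Fin m)),
      ‖y1‖ < r → ‖y2‖ < r → |Φ u y1 - Φ u y2| ≤ C * f2 ‖u‖ * ‖y1 - y2‖) :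
    (∀ y : EuclideanSpace ℝ (Fin m),
      Integrable (fun u => Real.exp (-(Φ u y))) μ0 ∧
      0 < ∫ u, Real.exp (-(Φ u y)) ∂μ0 ∧
      IsProbabilityMeasure
        (μ0.withDensity (fun u =>
          ENNReal.ofReal (Real.exp (-(Φ u y)) / ∫ v, Real.exp (-(Φ v y)) ∂μ0)))) ∧
    (Integrable (fun u => f2 ‖u‖) μ0 →
      ∀ r > 0, ∃ C' > 0, ∀ y y' : EuclideanSpace ℝ (Fin m), ‖y‖ < r → ‖y'‖ < r →
        (1 / 2) * ∫ u,
            |Real.exp (-(Φ u y)) / (∫ v, Real.exp (-(Φ v y)) ∂μ0) -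
              Real.exp (-(Φ u y')) / (∫ v, Real.exp (-(Φ v y')) ∂μ0)| ∂μ0
          ≤ C' * ‖y - y'‖) ∧
    (Integrable (fun u => (f2 ‖u‖) ^ 2) μ0 →
      ∀ r > 0, ∃ C'' > 0, ∀ y y' : EuclideanSpace ℝ (Fin m), ‖y‖ < r → ‖y'‖ < r →
        Real.sqrt ((1 / 2) * ∫ u,
            (Real.sqrt (Real.exp (-(Φ u y)) / (∫ v, Real.exp (-(Φ v y)) ∂μ0)) -
              Real.sqrt (Real.exp (-(Φ u y')) / (∫ v, Real.exp (-(Φ v y')) ∂μ0))) ^ 2 ∂μ0)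
          ≤ C'' * ‖y - y'‖) := by
  have hinteg : ∀ y, Integrable (fun u => exp (-(Φ u y))) μ0 := fun y =>
    (integrable_const (1 : ℝ)).mono' (hmeas y).neg.exp.aestronglyMeasurable
      (.of_forall fun u => by
        rw [norm_of_nonneg (exp_pos _).le]
        exact exp_le_one_iff.2 (neg_nonpos.2 (hnonneg u y)))
  have hlower : ∀ r > 0, ∃ c > 0, ∀ y : EuclideanSpace ℝ (Fin m), ‖y‖ < r →
      c ≤ ∫ u, exp (-(Φ u y)) ∂μ0 := fun r hr =>
    exists_pos_le_integral_exp_neg μ0 Φ {y | ‖y‖ < r} hinteg fun R => by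
      obtain ⟨K, -, hK⟩ := hii (max r R) (lt_max_of_lt_left hr)
      exact ⟨K, fun u y hy hu => hK u y (lt_max_of_lt_right hu) (lt_max_of_lt_left hy)⟩
  have hZpos : ∀ y, 0 < ∫ u, exp (-(Φ u y)) ∂μ0 := fun y => by
    obtain ⟨c, hc, hle⟩ := hlower (‖y‖ + 1) (by positivity)
    exact hc.trans_le (hle y (lt_add_one _))
  refine ⟨fun y => ⟨hinteg y, hZpos y, ⟨?_⟩⟩, fun hf r hr => ?_, fun hf r hr => ?_⟩
  · rw [withDensity_apply _ MeasurableSet.univ, Measure.restrict_univ,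
      ← ofReal_integral_eq_lintegral_ofReal ((hinteg y).div_const _)
        (.of_forall fun u => div_nonneg (exp_pos _).le (hZpos y).le),
      integral_div, div_self (hZpos y).ne', ENNReal.ofReal_one]
  · obtain ⟨c, hc, hle⟩ := hlower r hr
    obtain ⟨C, hC, hlip⟩ := hiv r hr
    have hI : 0 ≤ ∫ u, f2 ‖u‖ ∂μ0 := integral_nonneg fun u => hf2_nonneg _ (norm_nonneg u)
    refine ⟨C * (∫ u, f2 ‖u‖ ∂μ0) / c + 1, by positivity, fun y y' hy hy' => ?_⟩
    have hL1 : ∫ u, |exp (-(Φ u y)) - exp (-(Φ u y'))| ∂μ0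
        ≤ C * (∫ u, f2 ‖u‖ ∂μ0) * ‖y - y'‖ := by
      rw [← integral_const_mul, ← integral_mul_const]
      exact integral_mono ((hinteg y).sub (hinteg y')).abs ((hf.const_mul C).mul_const _) fun u =>
        (abs_exp_neg_sub_exp_neg_le_s5 (hnonneg u y) (hnonneg u y')).trans (hlip u y y' hy hy')
    have hTV := integral_abs_div_integral_sub_le_s5 (hinteg y) (hinteg y') (fun u => (exp_pos _).le)
      (hZpos y) (hZpos y')
    have hbound : 2 / (∫ u, exp (-(Φ u y)) ∂μ0)
          * ∫ u, |exp (-(Φ u y)) - exp (-(Φ u y'))| ∂μ0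
        ≤ 2 / c * (C * (∫ u, f2 ‖u‖ ∂μ0) * ‖y - y'‖) := by
      gcongr
      exact hle y hy
    calc _ ≤ 1 / 2 * (2 / c * (C * (∫ u, f2 ‖u‖ ∂μ0) * ‖y - y'‖)) := by
          gcongr
          exact hTV.trans hbound
      _ = C * (∫ u, f2 ‖u‖ ∂μ0) / c * ‖y - y'‖ := by ring
      _ ≤ _ := by
          gcongr
          linarith
  · obtain ⟨c, hc, hle⟩ := hlower r hr
    obtain ⟨C, hC, hlip⟩ := hiv r hr
    have hI : 0 ≤ ∫ u, f2 ‖u‖ ^ 2 ∂μ0 := integral_nonneg fun u => sq_nonneg _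
    set M := C ^ 2 * (∫ u, f2 ‖u‖ ^ 2 ∂μ0) / c with hM
    have hM0 : 0 ≤ M := by positivity
    refine ⟨M + 1, by positivity, fun y y' hy hy' => ?_⟩
    have hpoint : ∀ u, (√(exp (-(Φ u y))) - √(exp (-(Φ u y')))) ^ 2
        ≤ C ^ 2 * f2 ‖u‖ ^ 2 * ‖y - y'‖ ^ 2 := fun u => by
      have hhalf := abs_exp_neg_sub_exp_neg_le_s5 (div_nonneg (hnonneg u y) zero_le_two)
        (div_nonneg (hnonneg u y') zero_le_two)
      rw [← sub_div, abs_div, abs_two] at hhalf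
      rw [← exp_half, ← exp_half, neg_div, neg_div, ← sq_abs, ← mul_pow, ← mul_pow]
      refine pow_le_pow_left₀ (abs_nonneg _) ?_ 2
      linarith [hlip u y y' hy hy', abs_nonneg (Φ u y - Φ u y')]
    have hL2 : ∫ u, (√(exp (-(Φ u y))) - √(exp (-(Φ u y')))) ^ 2 ∂μ0
        ≤ C ^ 2 * (∫ u, f2 ‖u‖ ^ 2 ∂μ0) * ‖y - y'‖ ^ 2 := by
      rw [← integral_const_mul, ← integral_mul_const]
      exact integral_mono_of_nonneg (.of_forall fun u => sq_nonneg _)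
        ((hf.const_mul _).mul_const _) (.of_forall hpoint)
    have hH := integral_sq_sqrt_div_integral_sub_le (hinteg y) (hinteg y') (fun u => (exp_pos _).le)
      (fun u => (exp_pos _).le) (hZpos y) (hZpos y')
    have hden : c ≤ √(∫ u, exp (-(Φ u y)) ∂μ0) * √(∫ u, exp (-(Φ u y')) ∂μ0) := by
      calc c = √c * √c := (mul_self_sqrt hc.le).symm
        _ ≤ _ := by
          gcongr
          · exact hle y hy
          · exact hle y' hy'
    have hbound : ∫ u, (√(exp (-(Φ u y)) / ∫ v, exp (-(Φ v y)) ∂μ0)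
        - √(exp (-(Φ u y')) / ∫ v, exp (-(Φ v y')) ∂μ0)) ^ 2 ∂μ0 ≤ M * ‖y - y'‖ ^ 2 := by
      refine hH.trans ((div_le_div₀ (by positivity) hL2 hc hden).trans_eq ?_)
      rw [hM]
      ring
    rw [sqrt_le_left (by positivity), mul_pow]
    have hsq : M * ‖y - y'‖ ^ 2 ≤ (M + 1) ^ 2 * ‖y - y'‖ ^ 2 := by
      gcongr
      nlinarith
    have hMd : 0 ≤ M * ‖y - y'‖ ^ 2 := by positivity
    linarith
end

section
/- Let X be a separable Banach space and h : ℝ → [0,∞) a submultiplicative function, i.e. nonnegative, nondecreasing, locally bounded, and satisfying h(t+s) ≤ C h(t) h(s) for all t, s ∈ ℝ for some C > 0. Let m ∈ X, let γ be a Gaussian measure on X (a Borel probability measure whose pushforward under every continuous linear functional on X is a Gaussian measure on ℝ), let c > 0 and let η be a Borel probability measure on X, and set ν := e^{−c} Σ_{k=0}^∞ (c^k/k!) η^{∗k} (the compound Poisson measure with intensity c and jump distribution η). Define μ := δ_m ∗ γ ∗ ν. If ∫_X h(‖x‖_X) dη(x) < ∞, then ∫_X h(‖x‖_X) dμ(x)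 < ∞. -/
open MeasureTheory Real ProbabilityTheory

/-- Convolution of two Borel measures on an additive group: the pushforward of
the product measure under addition. -/
noncomputable def mconv {X : Type*} [MeasurableSpace X] [Add X]
    (μ ν : Measure X) : Measure X :=
  Measure.map (fun p : X × X => p.1 + p.2) (μ.prod ν)

/-- The k-fold convolution power, with `η^{∗0} = δ₀`. -/
noncomputable def mconvPow {X : Type*} [MeasurableSpace X] [Add X] [Zero X]
    (η : Measure X) : ℕ → Measure X
  | 0 => Measure.dirac 0
  | (k + 1) => mconv (mconvPow η k) η

open scoped ENNReal

section Submultiplicative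

variable {X : Type*} [MeasurableSpace X]

lemma lintegral_mconv_le [Add X] [MeasurableAdd₂ X] {g : X → ℝ≥0∞} (hg : Measurable g) {K : ℝ≥0∞}
    (hK : ∀ x y, g (x + y) ≤ K * g x * g y) (μ ν : Measure X) [SFinite ν] :
    ∫⁻ x, g x ∂(mconv μ ν) ≤ K * (∫⁻ x, g x ∂μ) * ∫⁻ x, g x ∂ν := by
  rw [mconv, lintegral_map hg (by fun_prop)]
  calc ∫⁻ p : X × X, g (p.1 + p.2) ∂(μ.prod ν)
      ≤ ∫⁻ p : X × X, (K * g p.1) * g p.2 ∂(μ.prod ν) := lintegral_mono fun p => hK _ _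
    _ = (∫⁻ x, K * g x ∂μ) * ∫⁻ x, g x ∂ν :=
        lintegral_prod_mul (hg.const_mul K).aemeasurable hg.aemeasurable
    _ = K * (∫⁻ x, g x ∂μ) * ∫⁻ x, g x ∂ν := by rw [lintegral_const_mul _ hg]

instance isProbabilityMeasure_mconv [Add X] [MeasurableAdd₂ X] (μ ν : Measure X)
    [IsProbabilityMeasure μ] [IsProbabilityMeasure ν] : IsProbabilityMeasure (mconv μ ν) :=
  Measure.isProbabilityMeasure_map (by fun_prop)

instance isProbabilityMeasure_mconvPow [Add X] [Zero X] [MeasurableAdd₂ X] (η : Measure X)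
    [IsProbabilityMeasure η] (k : ℕ) : IsProbabilityMeasure (mconvPow η k) := by
  induction k with
  | zero => exact Measure.dirac.isProbabilityMeasure
  | succ k ih => exact isProbabilityMeasure_mconv _ _

lemma lintegral_mconvPow_le [Add X] [Zero X] [MeasurableAdd₂ X] {g : X → ℝ≥0∞}
    (hg : Measurable g) {K : ℝ≥0∞} (hK : ∀ x y, g (x + y) ≤ K * g x * g y)
    (η : Measure X) [IsProbabilityMeasure η] (k : ℕ) :
    ∫⁻ x, g x ∂(mconvPow η k) ≤ g 0 * (K * ∫⁻ x, g x ∂η) ^ k := by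
  induction k with
  | zero => simp [mconvPow, lintegral_dirac' _ hg]
  | succ k ih =>
    calc ∫⁻ x, g x ∂(mconvPow η (k + 1))
        ≤ K * (∫⁻ x, g x ∂(mconvPow η k)) * ∫⁻ x, g x ∂η := lintegral_mconv_le hg hK _ _
      _ ≤ K * (g 0 * (K * ∫⁻ x, g x ∂η) ^ k) * ∫⁻ x, g x ∂η := by gcongr
      _ = g 0 * (K * ∫⁻ x, g x ∂η) ^ (k + 1) := by ring

lemma tsum_poisson_weight_mul_pow_lt_top {c : ℝ} (hc : 0 ≤ c) {a : ℝ≥0∞} (ha : a ≠ ∞) :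
    ∑' k : ℕ, ENNReal.ofReal (exp (-c) * c ^ k / k.factorial) * a ^ k < ∞ := by
  lift a to NNReal using ha
  have hsum : Summable fun k : ℕ => exp (-c) * ((c * a) ^ k / k.factorial) :=
    (Real.summable_pow_div_factorial (c * a)).mul_left _
  refine lt_of_le_of_lt (ENNReal.tsum_le_tsum fun k => ?_) hsum.tsum_ofReal_lt_top
  rw [← ENNReal.ofReal_coe_nnreal, ← ENNReal.ofReal_pow a.coe_nonneg,
    ← ENNReal.ofReal_mul (by positivity)]
  refine (congrArg _ ?_).le
  rw [mul_pow]
  ring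

lemma lintegral_compoundPoisson_lt_top [Add X] [Zero X] [MeasurableAdd₂ X] {g : X → ℝ≥0∞}
    (hg : Measurable g) (hg0 : g 0 ≠ ∞) {K : ℝ≥0∞} (hK_top : K ≠ ∞)
    (hK : ∀ x y, g (x + y) ≤ K * g x * g y) {c : ℝ} (hc : 0 ≤ c)
    (η : Measure X) [IsProbabilityMeasure η] (hη : ∫⁻ x, g x ∂η ≠ ∞) :
    ∫⁻ x, g x ∂(Measure.sum fun k : ℕ =>
      ENNReal.ofReal (exp (-c) * c ^ k / k.factorial) • mconvPow η k) < ∞ := by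
  rw [lintegral_sum_measure]
  calc ∑' k : ℕ, ∫⁻ x, g x ∂(ENNReal.ofReal (exp (-c) * c ^ k / k.factorial) • mconvPow η k)
      ≤ ∑' k : ℕ, g 0 * (ENNReal.ofReal (exp (-c) * c ^ k / k.factorial) *
          (K * ∫⁻ x, g x ∂η) ^ k) := by
        refine ENNReal.tsum_le_tsum fun k => ?_
        rw [lintegral_smul_measure, smul_eq_mul, mul_left_comm]
        gcongr
        exact lintegral_mconvPow_le hg hK η k
    _ < ∞ := by
        rw [ENNReal.tsum_mul_left]
        exact ENNReal.mul_lt_top hg0.lt_top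
          (tsum_poisson_weight_mul_pow_lt_top hc (ENNReal.mul_ne_top hK_top hη))

end Submultiplicative

/-- A monotone submultiplicative function grows at most exponentially on `[0, ∞)`. -/
lemma le_mul_exp_of_submultiplicative {h : ℝ → ℝ} (h_nonneg : ∀ t, 0 ≤ h t) (h_mono : Monotone h)
    {C : ℝ} (hC : 0 ≤ C) (h_submult : ∀ t s, h (t + s) ≤ C * h t * h s) {t : ℝ} (ht : 0 ≤ t) :
    h t ≤ h 0 * exp (C * h 1 * (t + 1)) := by
  have hb : 0 ≤ C * h 1 := mul_nonneg hC (h_nonneg 1)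
  have h_nat (n : ℕ) : h n ≤ h 0 * exp (C * h 1 * n) := by
    induction n with
    | zero => simp
    | succ n ih =>
      calc h ((n + 1 : ℕ) : ℝ) ≤ C * h n * h 1 := by
            push_cast
            exact h_submult _ _
        _ = h n * (C * h 1) := by ring
        _ ≤ (h 0 * exp (C * h 1 * n)) * exp (C * h 1) :=
            mul_le_mul ih (by linarith [add_one_le_exp (C * h 1)]) hb
              (mul_nonneg (h_nonneg 0) (exp_pos _).le)
        _ = h 0 * exp (C * h 1 * ((n + 1 : ℕ) : ℝ)) := by
            rw [mul_assoc, ← exp_add]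
            push_cast
            ring_nf
  calc h t ≤ h ⌈t⌉₊ := h_mono (Nat.le_ceil t)
    _ ≤ h 0 * exp (C * h 1 * ⌈t⌉₊) := h_nat _
    _ ≤ h 0 * exp (C * h 1 * (t + 1)) := by
        have := (Nat.ceil_lt_add_one ht).le
        have := h_nonneg 0
        gcongr

lemma integrable_exp_mul_norm_of_isGaussian {X : Type*} [NormedAddCommGroup X] [NormedSpace ℝ X]
    [CompleteSpace X] [MeasurableSpace X] [BorelSpace X] [SecondCountableTopology X]
    (γ : Measure X) [IsGaussian γ] (b : ℝ) : Integrable (fun x => exp (b * ‖x‖)) γ := by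
  obtain ⟨a, ha, hint⟩ := IsGaussian.exists_integrable_exp_sq γ
  refine (hint.const_mul (exp (b ^ 2 / (4 * a)))).mono' (by fun_prop) (.of_forall fun x => ?_)
  rw [norm_of_nonneg (exp_pos _).le, ← exp_add, exp_le_exp, ← sub_nonneg]
  have : b ^ 2 / (4 * a) + a * ‖x‖ ^ 2 - b * ‖x‖ = (2 * a * ‖x‖ - b) ^ 2 / (4 * a) := by
    field_simp
    ring
  rw [this]
  positivity

/-- Tail transfer for infinitely divisible measures with finite
Lévy measure: if `μ = δ_m ∗ γ ∗ ν` where `γ` is Gaussian and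
`ν = CPois(c, η)` is compound Poisson, and the submultiplicative function
`h(‖·‖)` is `η`-integrable, then `h(‖·‖)` is `μ`-integrable. -/
theorem id_measure_submultiplicative_moment
    {X : Type*} [NormedAddCommGroup X] [NormedSpace ℝ X] [CompleteSpace X]
    [MeasurableSpace X] [BorelSpace X] [SecondCountableTopology X]
    (h : ℝ → ℝ)
    (h_nonneg : ∀ t : ℝ, 0 ≤ h t)
    (h_mono : Monotone h)
    (h_locbdd : ∀ R > 0, ∃ B : ℝ, ∀ t : ℝ, |t| ≤ R → h t ≤ B)
    (h_submult : ∃ C > 0, ∀ t s : ℝ, h (t + s) ≤ C * h t * h s)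
    (m : X)
    (γ : Measure X) [IsProbabilityMeasure γ]
    (hγ : ∀ L : X →L[ℝ] ℝ, ∃ (a : ℝ) (v : NNReal),
      Measure.map L γ = ProbabilityTheory.gaussianReal a v)
    (c : ℝ) (hc : 0 < c)
    (η : Measure X) [IsProbabilityMeasure η]
    (hη : Integrable (fun x => h ‖x‖) η) :
    Integrable (fun x => h ‖x‖)
      (mconv (mconv (Measure.dirac m) γ)
        (Measure.sum (fun k : ℕ =>
          (ENNReal.ofReal (Real.exp (-c) * c ^ k / (Nat.factorial k))) • mconvPow η k))) := by
  obtain ⟨C, hC, h_submult⟩ := h_submult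
  have : IsGaussian γ := isGaussian_of_map_eq_gaussianReal hγ
  have hmeas : Measurable fun x : X => h ‖x‖ := h_mono.measurable.comp measurable_norm
  set g : X → ℝ≥0∞ := fun x => ENNReal.ofReal (h ‖x‖) with hg_def
  have hg : Measurable g := hmeas.ennreal_ofReal
  have hK (x y : X) : g (x + y) ≤ ENNReal.ofReal C * g x * g y := by
    rw [hg_def, ← ENNReal.ofReal_mul hC.le, ← ENNReal.ofReal_mul (mul_nonneg hC.le (h_nonneg _))]
    exact ENNReal.ofReal_le_ofReal ((h_mono (norm_add_le x y)).trans (h_submult _ _))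
  have integrable_iff (ρ : Measure X) : Integrable (fun x => h ‖x‖) ρ ↔ ∫⁻ x, g x ∂ρ < ∞ := by
    rw [← hasFiniteIntegral_iff_ofReal (.of_forall fun x => h_nonneg _)]
    exact and_iff_right hmeas.aestronglyMeasurable
  have hγ_fin : ∫⁻ x, g x ∂γ < ∞ := by
    rw [← integrable_iff]
    refine ((integrable_exp_mul_norm_of_isGaussian γ (C * h 1)).const_mul
      (h 0 * exp (C * h 1))).mono' hmeas.aestronglyMeasurable (.of_forall fun x => ?_)
    rw [norm_of_nonneg (h_nonneg _), mul_assoc, ← exp_add]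
    convert le_mul_exp_of_submultiplicative h_nonneg h_mono hC.le h_submult (norm_nonneg x) using 3
    ring
  have hν_fin := lintegral_compoundPoisson_lt_top hg ENNReal.ofReal_ne_top ENNReal.ofReal_ne_top
    hK hc.le η ((integrable_iff η).1 hη).ne
  rw [integrable_iff]
  refine (lintegral_mconv_le hg hK _ _).trans_lt (ENNReal.mul_lt_top (ENNReal.mul_lt_top
    ENNReal.ofReal_lt_top ((lintegral_mconv_le hg hK _ _).trans_lt ?_)) hν_fin)
  rw [lintegral_dirac' _ hg]
  exact ENNReal.mul_lt_top (ENNReal.mul_lt_top ENNReal.ofReal_lt_top ENNReal.ofReal_lt_top) hγ_fin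
end

section
/- Let X be a Banach space, let μ1 and μ2 be Borel probability measures on X, both absolutely continuous with respect to a σ-finite measure ν, and let h : X → ℝ be measurable with h ∈ L²(X, μ1) ∩ L²(X, μ2). Then |∫_X h(u) dμ1(u) − ∫_X h(u) dμ2(u)| ≤ 2 ( ∫_X h(u)² dμ1(u) + ∫_X h(u)² dμ2(u) )^{1/2} · d_H(μ1, μ2). -/
open MeasureTheory Real

/-- The Cauchy–Schwarz inequality for square-integrable real functions. -/
theorem abs_integral_mul_le_sqrt_mul_sqrt {α : Type*} [MeasurableSpace α] {μ : Measure α}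
    {f g : α → ℝ} (hf : MemLp f 2 μ) (hg : MemLp g 2 μ) :
    |∫ x, f x * g x ∂μ| ≤ √(∫ x, f x ^ 2 ∂μ) * √(∫ x, g x ^ 2 ∂μ) := by
  have holder := integral_mul_norm_le_Lp_mul_Lq (μ := μ) (f := f) (g := g)
    Real.HolderConjugate.two_two (by simpa using hf) (by simpa using hg)
  simp only [Real.rpow_two, Real.norm_eq_abs, sq_abs, ← Real.sqrt_eq_rpow] at holder
  calc |∫ x, f x * g x ∂μ| ≤ ∫ x, |f x * g x| ∂μ := abs_integral_le_integral_abs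
    _ = ∫ x, |f x| * |g x| ∂μ := by simp only [abs_mul]
    _ ≤ _ := holder

/-- The Hellinger distance bounds differences of expectations:
for probability measures `μ1, μ2 ≪ ν` and `h ∈ L²(μ1) ∩ L²(μ2)`,
`|∫ h dμ1 − ∫ h dμ2| ≤ 2(∫ h² dμ1 + ∫ h² dμ2)^{1/2} d_H(μ1, μ2)`. -/
theorem hellinger_bounds_expectation
    {X : Type*} [MeasurableSpace X]
    (ν : Measure X) [SigmaFinite ν]
    (μ1 μ2 : Measure X) [IsProbabilityMeasure μ1] [IsProbabilityMeasure μ2]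
    (h1 : μ1 ≪ ν) (h2 : μ2 ≪ ν)
    (h : X → ℝ) (hmeas : Measurable h)
    (hL1 : Integrable (fun u => h u ^ 2) μ1)
    (hL2 : Integrable (fun u => h u ^ 2) μ2) :
    |(∫ u, h u ∂μ1) - ∫ u, h u ∂μ2|
      ≤ 2 * Real.sqrt ((∫ u, h u ^ 2 ∂μ1) + ∫ u, h u ^ 2 ∂μ2) *
        Real.sqrt ((1 / 2) * ∫ u,
          (Real.sqrt ((μ1.rnDeriv ν u).toReal) -
            Real.sqrt ((μ2.rnDeriv ν u).toReal)) ^ 2 ∂ν) := by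
  set a : X → ℝ := fun u => (μ1.rnDeriv ν u).toReal
  set b : X → ℝ := fun u => (μ2.rnDeriv ν u).toReal
  have ha_meas : Measurable a := (Measure.measurable_rnDeriv μ1 ν).ennreal_toReal
  have hb_meas : Measurable b := (Measure.measurable_rnDeriv μ2 ν).ennreal_toReal
  have ha_nonneg (u : X) : 0 ≤ a u := ENNReal.toReal_nonneg
  have hb_nonneg (u : X) : 0 ≤ b u := ENNReal.toReal_nonneg
  have ha_int : Integrable a ν := Measure.integrable_toReal_rnDeriv
  have hb_int : Integrable b ν := Measure.integrable_toReal_rnDeriv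
  have hh1 : Integrable h μ1 :=
    ((memLp_two_iff_integrable_sq hmeas.aestronglyMeasurable).2 hL1).integrable one_le_two
  have hh2 : Integrable h μ2 :=
    ((memLp_two_iff_integrable_sq hmeas.aestronglyMeasurable).2 hL2).integrable one_le_two
  have hah : Integrable (fun u => a u * h u) ν := (integrable_toReal_rnDeriv_mul_iff h1).2 hh1
  have hbh : Integrable (fun u => b u * h u) ν := (integrable_toReal_rnDeriv_mul_iff h2).2 hh2
  have hah2 : Integrable (fun u => a u * h u ^ 2) ν :=
    (integrable_toReal_rnDeriv_mul_iff h1).2 hL1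
  have hbh2 : Integrable (fun u => b u * h u ^ 2) ν :=
    (integrable_toReal_rnDeriv_mul_iff h2).2 hL2
  have hdom : Integrable (fun u => 2 * (a u * h u ^ 2 + b u * h u ^ 2)) ν :=
    (hah2.add hbh2).const_mul 2
  have hsum_le (u : X) :
      (h u * (√(a u) + √(b u))) ^ 2 ≤ 2 * (a u * h u ^ 2 + b u * h u ^ 2) := by
    have hab : (√(a u) + √(b u)) ^ 2 ≤ 2 * (a u + b u) := by
      nlinarith [sq_nonneg (√(a u) - √(b u)), Real.sq_sqrt (ha_nonneg u),
        Real.sq_sqrt (hb_nonneg u)]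
    calc (h u * (√(a u) + √(b u))) ^ 2 = h u ^ 2 * (√(a u) + √(b u)) ^ 2 := by ring
      _ ≤ h u ^ 2 * (2 * (a u + b u)) := by gcongr
      _ = _ := by ring
  have hsum_meas : Measurable fun u => h u * (√(a u) + √(b u)) := by fun_prop
  have hsum_int : Integrable (fun u => (h u * (√(a u) + √(b u))) ^ 2) ν :=
    hdom.mono' (hsum_meas.pow_const 2).aestronglyMeasurable
      (.of_forall fun u => by simpa only [Real.norm_eq_abs, abs_sq] using hsum_le u)
  have hdiff_int : Integrable (fun u => (√(a u) - √(b u)) ^ 2) ν := by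
    refine (ha_int.add hb_int).mono' (by fun_prop) (.of_forall fun u => ?_)
    rw [Real.norm_eq_abs, abs_sq, Pi.add_apply]
    nlinarith [Real.sq_sqrt (ha_nonneg u), Real.sq_sqrt (hb_nonneg u),
      mul_nonneg (Real.sqrt_nonneg (a u)) (Real.sqrt_nonneg (b u))]
  have hexp : (∫ u, h u ∂μ1) - ∫ u, h u ∂μ2
      = ∫ u, (h u * (√(a u) + √(b u))) * (√(a u) - √(b u)) ∂ν := by
    rw [← integral_toReal_rnDeriv_mul h1, ← integral_toReal_rnDeriv_mul h2,
      ← integral_sub hah hbh]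
    refine integral_congr_ae (.of_forall fun u => ?_)
    change a u * h u - b u * h u = _
    linear_combination h u * (Real.sq_sqrt (hb_nonneg u) - Real.sq_sqrt (ha_nonneg u))
  have hsum_integral_le : ∫ u, (h u * (√(a u) + √(b u))) ^ 2 ∂ν
      ≤ 2 * ((∫ u, h u ^ 2 ∂μ1) + ∫ u, h u ^ 2 ∂μ2) := by
    rw [← integral_toReal_rnDeriv_mul h1, ← integral_toReal_rnDeriv_mul h2,
      ← integral_add hah2 hbh2, ← integral_const_mul]
    exact integral_mono hsum_int hdom hsum_le
  have hsqrt : 2 * √(1 / 2) = √2 := by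
    rw [one_div, Real.sqrt_inv, ← div_eq_mul_inv, Real.div_sqrt]
  rw [hexp]
  calc _ ≤ √(∫ u, (h u * (√(a u) + √(b u))) ^ 2 ∂ν) * √(∫ u, (√(a u) - √(b u)) ^ 2 ∂ν) :=
        abs_integral_mul_le_sqrt_mul_sqrt
          ((memLp_two_iff_integrable_sq hsum_meas.aestronglyMeasurable).2 hsum_int)
          ((memLp_two_iff_integrable_sq (by fun_prop)).2 hdiff_int)
    _ ≤ √(2 * ((∫ u, h u ^ 2 ∂μ1) + ∫ u, h u ^ 2 ∂μ2)) * √(∫ u, (√(a u) - √(b u)) ^ 2 ∂ν) := by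
        gcongr
    _ = _ := by
        rw [Real.sqrt_mul (by norm_num), Real.sqrt_mul (by norm_num), ← hsqrt]
        ring
end
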